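/- arXiv:2005.05644 — 2 statements merged into one kernel-verified Lean document; each statement's English description precedes it below -/
import Mathlib

section
/- Let R be a commutative ring, n a natural number, and X a (2n)×(2n) matrix over R (indexed by Fin n ⊕ Fin n) satisfying the Hamiltonian condition Xᵀ·J + J·X = 0, where J is the standard symplectic matrix. Then every coefficient of odd degree of the characteristic polynomial of X vanishes; that is, the characteristic polynomial has the form P(v) = v^{2n} + Q_2·v^{2n−2} + Q_4·v^{2n−4} + ⋯ + Q_{2n−2}·v² + Q_{2n}, containing only even powers of v. -/
open Matrix

section

variable {R ι : Type*} [CommRing R] [Fintype ι] [DecidableEq ι]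

theorem Matrix.charpoly_neg_eq_comp (M : Matrix ι ι R) :
    (-M).charpoly =
      (-1) ^ Fintype.card ι * M.charpoly.comp (Polynomial.C (-1) * Polynomial.X) := by
  have h : (Polynomial.compRingHom (Polynomial.C (-1 : R) * Polynomial.X)).mapMatrix
      M.charmatrix = -(-M).charmatrix := by
    ext1 i j
    by_cases hij : i = j
    · subst hij
      simp [charmatrix_apply_eq, sub_eq_add_neg, add_comm]
    · simp [charmatrix_apply_ne _ _ _ hij]
  rw [charpoly, charpoly, ← Polynomial.coe_compRingHom_apply, RingHom.map_det, h, det_neg,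
    ← mul_assoc, ← mul_pow]
  simp

theorem Matrix.coeff_charpoly_neg (M : Matrix ι ι R) (k : ℕ) :
    (-M).charpoly.coeff k = (-1) ^ Fintype.card ι * (-1) ^ k * M.charpoly.coeff k := by
  have h : ((-1) ^ Fintype.card ι : Polynomial R) = Polynomial.C ((-1) ^ Fintype.card ι) := by
    simp
  rw [charpoly_neg_eq_comp, h, Polynomial.coeff_C_mul, Polynomial.comp_C_mul_X_coeff]
  ring

/-- The product of a skew-symmetric and a symmetric matrix of even size has an even
characteristic polynomial, provided the base ring has no `2`-torsion. -/
theorem Matrix.coeff_charpoly_mul_eq_zero_of_two_torsionFree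
    (h2 : ∀ a : R, 2 * a = 0 → a = 0) (hι : Even (Fintype.card ι))
    {A S : Matrix ι ι R} (hA : Aᵀ = -A) (hS : Sᵀ = S) {k : ℕ} (hk : Odd k) :
    (A * S).charpoly.coeff k = 0 := by
  have h : (A * S).charpoly = (-(A * S)).charpoly := by
    rw [← charpoly_transpose, transpose_mul, hA, hS, charpoly_mul_comm, Matrix.neg_mul]
  have hcoeff := coeff_charpoly_neg (A * S) k
  rw [← h, hι.neg_one_pow, hk.neg_one_pow] at hcoeff
  apply h2
  linear_combination hcoeff

/-- Over an arbitrary commutative ring, the symmetric factor is lifted to a polynomial ring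
over `ℤ`. -/
theorem Matrix.coeff_charpoly_J_mul_eq_zero {S : Matrix (ι ⊕ ι) (ι ⊕ ι) R} (hS : Sᵀ = S)
    {k : ℕ} (hk : Odd k) : (J ι R * S).charpoly.coeff k = 0 := by
  let f : MvPolynomial R ℤ →+* R := (MvPolynomial.aeval (id : R → R)).toRingHom
  let T : Matrix (ι ⊕ ι) (ι ⊕ ι) (MvPolynomial R ℤ) := S.map MvPolynomial.X
  have hT : Tᵀ = T := by rw [← transpose_map, hS]
  have hTS : T.map f = S := by
    ext i j
    simp [T, f]
  have hmap : (J ι (MvPolynomial R ℤ) * T).map f = J ι R * S := by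
    rw [Matrix.map_mul, map_J, hTS]
  rw [← hmap, charpoly_map, Polynomial.coeff_map,
    coeff_charpoly_mul_eq_zero_of_two_torsionFree (fun a ha => by simpa using ha)
      (by simp) (J_transpose ι _) hT hk, map_zero]

end

/-- If `X` is a Hamiltonian `(2n)×(2n)` matrix over a commutative ring `R`
(i.e. `Xᵀ * J + J * X = 0` with `J` the standard symplectic matrix), then every
odd-degree coefficient of the characteristic polynomial of `X` vanishes, i.e. the
characteristic polynomial contains only even powers of the variable. -/
theorem charpoly_odd_coeff_eq_zero_of_hamiltonian (R : Type*) [CommRing R] (n : ℕ)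
    (X : Matrix (Fin n ⊕ Fin n) (Fin n ⊕ Fin n) R)
    (hX : Xᵀ * Matrix.J (Fin n) R + Matrix.J (Fin n) R * X = 0) :
    ∀ k : ℕ, Odd k → X.charpoly.coeff k = 0 := by
  intro k hk
  have hS : (-(J (Fin n) R * X))ᵀ = -(J (Fin n) R * X) := by
    rw [transpose_neg, transpose_mul, J_transpose, Matrix.mul_neg, neg_neg]
    exact eq_neg_of_add_eq_zero_left hX
  have hX' : X = J (Fin n) R * -(J (Fin n) R * X) := by
    rw [Matrix.mul_neg, ← Matrix.mul_assoc, J_squared, Matrix.neg_mul, Matrix.one_mul, neg_neg]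
  rw [hX']
  exact coeff_charpoly_J_mul_eq_zero hS hk
end

section
/- Let R be a commutative ring, n ≥ 1 a natural number, and s_1, …, s_n ∈ R. Consider the 2n elements r indexed by Fin n ⊕ Fin n, where r(inl i) = s_i and r(inr i) = −s_i. Then the product over all ordered pairs of distinct indices (i,j) of (r_i − r_j) equals (−1)^{n(2n−1)} · 4ⁿ · (∏_{i=1}^{n} s_i²) · ( ∏ over all ordered pairs of distinct indices (i,j) in Fin n of (s_i² − s_j²) )². -/
open Finset

theorem Finset.prod_univ_offDiag {ι M : Type*} [Fintype ι] [DecidableEq ι] [CommMonoid M]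
    (f : ι × ι → M) :
    ∏ p ∈ (univ : Finset ι).offDiag, f p = ∏ i, ∏ j, if i = j then 1 else f (i, j) := by
  rw [← Fintype.prod_prod_type' (fun i j => if i = j then 1 else f (i, j)),
    ← Finset.prod_filter_mul_prod_filter_not univ (fun p : ι × ι => p.1 = p.2)]
  rw [Finset.prod_eq_one (fun p hp => if_pos (by simpa using hp)), one_mul]
  refine Finset.prod_congr (by ext; simp) fun p hp => ?_
  rw [if_neg (by simpa using hp)]

theorem Finset.prod_prod_eq_prod_diag_mul_prod_offDiag {ι M : Type*} [Fintype ι] [DecidableEq ι]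
    [CommMonoid M] (f : ι × ι → M) :
    ∏ i, ∏ j, f (i, j) = (∏ i, f (i, i)) * ∏ p ∈ (univ : Finset ι).offDiag, f p := by
  rw [prod_univ_offDiag, ← prod_mul_distrib]
  refine prod_congr rfl fun i _ => ?_
  have h : f (i, i) = ∏ j, if i = j then f (i, j) else 1 := by simp
  rw [h, ← prod_mul_distrib]
  refine prod_congr rfl fun j _ => ?_
  split_ifs <;> simp

/-- Discriminant factorization in terms of roots. For `s₁, …, sₙ ∈ R`, the
`2n` elements `r` indexed by `Fin n ⊕ Fin n` with `r (inl i) = sᵢ`, `r (inr i) = -sᵢ`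
satisfy: the product over all ordered pairs of distinct indices of `(rᵢ - rⱼ)` equals
`(-1)^(n(2n-1)) · 4ⁿ · (∏ sᵢ²) · (∏ over ordered pairs of distinct indices in Fin n of
(sᵢ² - sⱼ²))²`. -/
theorem prod_offDiag_sub_symm_roots (R : Type*) [CommRing R] (n : ℕ) (hn : 1 ≤ n)
    (s : Fin n → R) :
    (∏ p ∈ (Finset.univ : Finset (Fin n ⊕ Fin n)).offDiag,
        (Sum.elim s (fun i => -s i) p.1 - Sum.elim s (fun i => -s i) p.2)) =
      (-1) ^ (n * (2 * n - 1)) * 4 ^ n * (∏ i, s i ^ 2) *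
        (∏ p ∈ (Finset.univ : Finset (Fin n)).offDiag, (s p.1 ^ 2 - s p.2 ^ 2)) ^ 2 := by
  have hswap : (∏ i, ∏ j, if i = j then 1 else -s i + s j) =
      ∏ i, ∏ j, if i = j then 1 else s i - s j := by
    rw [prod_comm]
    refine prod_congr rfl fun i _ => prod_congr rfl fun j _ => ?_
    exact if_congr eq_comm rfl (neg_add_eq_sub _ _)
  have hneg : (∏ i, ∏ j, (-s i - s j)) = (-1) ^ (n * n) * ∏ i, ∏ j, (s i + s j) := by
    have h (i j : Fin n) : -s i - s j = -1 * (s i + s j) := by ring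
    simp only [h, prod_mul_distrib, prod_const, card_univ, Fintype.card_fin, pow_mul]
  have hadd : (∏ i, ∏ j, (s i + s j)) = (2 ^ n * ∏ i, s i) *
      ∏ p ∈ (univ : Finset (Fin n)).offDiag, (s p.1 + s p.2) := by
    rw [prod_prod_eq_prod_diag_mul_prod_offDiag (fun p : Fin n × Fin n => s p.1 + s p.2)]
    simp [← two_mul, prod_mul_distrib]
  have hsq : (∏ p ∈ (univ : Finset (Fin n)).offDiag, (s p.1 ^ 2 - s p.2 ^ 2)) =
      (∏ p ∈ (univ : Finset (Fin n)).offDiag, (s p.1 + s p.2)) *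
        ∏ p ∈ (univ : Finset (Fin n)).offDiag, (s p.1 - s p.2) := by
    simp only [sq_sub_sq, prod_mul_distrib]
  have hsign : (-1 : R) ^ (n * (2 * n - 1)) = (-1) ^ (n * n) := by
    obtain ⟨m, rfl⟩ := Nat.exists_eq_add_of_le' hn
    rw [show (m + 1) * (2 * (m + 1) - 1) = (m + 1) * (m + 1) + m * (m + 1) by
      rw [show 2 * (m + 1) - 1 = 2 * m + 1 by omega]; ring, pow_add,
      (Nat.even_mul_succ_self m).neg_one_pow, mul_one]
  have h4 : (4 : R) ^ n = (2 ^ n) ^ 2 := by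
    rw [← pow_mul, mul_comm n, pow_mul]; norm_num
  rw [prod_univ_offDiag]
  simp only [Fintype.prod_sum_type, Sum.elim_inl, Sum.elim_inr, Sum.inl.injEq, Sum.inr.injEq,
    reduceCtorEq, if_false, sub_neg_eq_add, prod_mul_distrib]
  rw [hswap]
  rw [hneg, hadd, hsq, hsign, h4, prod_pow,
    prod_univ_offDiag (fun p : Fin n × Fin n => s p.1 - s p.2)]
  ring
end
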